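/- The function Shove : ℙ → ℙ, given by Shove(x) = {n − min(x) : n ∈ x} for x non-empty and Shove(∅) = ∅, is not (𝒰 ∪ 𝒫)-definable. -/

import Mathlib

noncomputable section
open Classical

/-- `s ⊕ t`: lifted addition on sets of naturals. -/
def setPlus (s t : Set ℕ) : Set ℕ := {u | ∃ m ∈ s, ∃ n ∈ t, u = m + n}

/-- `s ⊗ t`: lifted multiplication on sets of naturals. -/
def setTimes (s t : Set ℕ) : Set ℕ := {u | ∃ m ∈ s, ∃ n ∈ t, u = m * n}

/-- Sets of naturals definable by (variable-free) arithmetic circuits: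
the smallest collection containing `∅`, `ℕ`, all singletons, closed under
union, intersection, complement, `⊕` and `⊗`. -/
inductive ArithDefinable : Set ℕ → Prop
  | empty : ArithDefinable ∅
  | univ : ArithDefinable Set.univ
  | single (k : ℕ) : ArithDefinable {k}
  | union : ∀ {s t : Set ℕ}, ArithDefinable s → ArithDefinable t → ArithDefinable (s ∪ t)
  | inter : ∀ {s t : Set ℕ}, ArithDefinable s → ArithDefinable t → ArithDefinable (s ∩ t)
  | compl : ∀ {s : Set ℕ}, ArithDefinable s → ArithDefinable sᶜ
  | plus : ∀ {s t : Set ℕ}, ArithDefinable s → ArithDefinable t → ArithDefinable (setPlus s t)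
  | times : ∀ {s t : Set ℕ}, ArithDefinable s → ArithDefinable t → ArithDefinable (setTimes s t)

/-- A set-function of arity `k`. -/
abbrev SetFun (k : ℕ) := (Fin k → Set ℕ) → Set ℕ

/-- The `𝒪`-definable functions `ℙ^n → ℙ`, for a collection `O` of set-functions
(given per arity): smallest class containing projections and the constants
`∅`, `ℕ`, `{k}`, closed under pointwise union, intersection, complement, and
composition with functions in `O`. -/
inductive ODef (O : ∀ k, Set (SetFun k)) (n : ℕ) : SetFun n → Prop
  | proj (i : Fin n) : ODef O n (fun s => s i)
  | empty : ODef O n (fun _ => ∅)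
  | univ : ODef O n (fun _ => Set.univ)
  | single (k : ℕ) : ODef O n (fun _ => {k})
  | union : ∀ {F G : SetFun n}, ODef O n F → ODef O n G → ODef O n (fun s => F s ∪ G s)
  | inter : ∀ {F G : SetFun n}, ODef O n F → ODef O n G → ODef O n (fun s => F s ∩ G s)
  | compl : ∀ {F : SetFun n}, ODef O n F → ODef O n (fun s => (F s)ᶜ)
  | comp : ∀ {k : ℕ} {g : SetFun k} {F : Fin k → SetFun n},
      g ∈ O k → (∀ i, ODef O n (F i)) → ODef O n (fun s => g (fun i => F i s))

/-- `s_{|m} = s ∩ {0,…,m}`. -/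
def restrict (s : Set ℕ) (m : ℕ) : Set ℕ := s ∩ {k | k ≤ m}

/-- `F` is `h`-continuous on `D`. -/
def HCont (h : ℕ → ℕ) {n : ℕ} (F : SetFun n) (D : Set (Fin n → Set ℕ)) : Prop :=
  ∀ m : ℕ, ∀ s ∈ D, ∀ t ∈ D,
    (∀ i, restrict (s i) (h m) = restrict (t i) (h m)) →
    restrict (F s) m = restrict (F t) m

/-- `F` is uniformly continuous on `D`. -/
def UnifCont {n : ℕ} (F : SetFun n) (D : Set (Fin n → Set ℕ)) : Prop :=
  ∃ h : ℕ → ℕ, HCont h F D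

/-- `𝒰`: set-functions (of arity `k`) uniformly continuous on the whole space. -/
def Ucal (k : ℕ) : Set (SetFun k) := {g | UnifCont g Set.univ}

/-- `𝒫`: predicates, i.e. set-functions with values among `∅` and `{0}`. -/
def Pcal (k : ℕ) : Set (SetFun k) := {g | ∀ s, g s = ∅ ∨ g s = {0}}

/-- `𝒰 ∪ 𝒫`. -/
def UPcal (k : ℕ) : Set (SetFun k) := Ucal k ∪ Pcal k

/-- `Max(x)`. -/
def MaxFun (x : Set ℕ) : Set ℕ :=
  if x = ∅ then ∅ else if x.Infinite then Set.univ else {sSup x}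

/-- `Card(x)`. -/
def CardFun (x : Set ℕ) : Set ℕ := if x.Finite then {x.ncard} else Set.univ

/-- `↓(x)`. -/
def DownFun (x : Set ℕ) : Set ℕ := {m | ∃ n ∈ x, m ≤ n}

/-- `Sum(x)`. -/
def SumFun (x : Set ℕ) : Set ℕ := if x.Finite then {∑ᶠ n ∈ x, n} else Set.univ

/-- `Prod(x)`. -/
def ProdFun (x : Set ℕ) : Set ℕ := if x.Finite then {∏ᶠ n ∈ x, n} else Set.univ

/-- `Shove(x) = {n - min x : n ∈ x}` (empty for `x = ∅`). -/
def ShoveFun (x : Set ℕ) : Set ℕ := (fun n => n - sInf x) '' x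

/-- `ε(x)`: the test for emptiness. -/
def epsFun (x : Set ℕ) : Set ℕ := if x = ∅ then {0} else ∅

/-- `Fin(x)`: the test for finiteness. -/
def FinFun (x : Set ℕ) : Set ℕ := if x.Finite then {0} else ∅

/-- `⊕` as a set-function of arity 2. -/
def plusFun : SetFun 2 := fun s => setPlus (s 0) (s 1)

/-- `⊗` as a set-function of arity 2. -/
def timesFun : SetFun 2 := fun s => setTimes (s 0) (s 1)

/-- `↓` as a set-function of arity 1. -/
def downFun1 : SetFun 1 := fun s => DownFun (s 0)

/-- `ε` as a set-function of arity 1. -/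
def epsFun1 : SetFun 1 := fun s => epsFun (s 0)

/-- The collection `{⊕, ⊗}`. -/
def arithO : ∀ k, Set (SetFun k)
  | 2 => {plusFun, timesFun}
  | _ => ∅

/-- The collection `{⊕}`. -/
def addO : ∀ k, Set (SetFun k)
  | 2 => {plusFun}
  | _ => ∅

/-- The collection `{⊕, ↓} ∪ 𝒫`. -/
def addDownO : ∀ k, Set (SetFun k)
  | 1 => insert downFun1 (Pcal 1)
  | 2 => insert plusFun (Pcal 2)
  | k => Pcal k

/-- The collection `{⊕, ⊗, ↓} ∪ 𝒫`. -/
def arithDownO : ∀ k, Set (SetFun k)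
  | 1 => insert downFun1 (Pcal 1)
  | 2 => {plusFun, timesFun} ∪ Pcal 2
  | k => Pcal k

/-- The collection `𝒰 ∪ {ε}`. -/
def UEps : ∀ k, Set (SetFun k)
  | 1 => insert epsFun1 (Ucal 1)
  | k => Ucal k

/-- The collection `{⊕, ⊗} ∪ 𝒫`. -/
def arithPO (k : ℕ) : Set (SetFun k) := arithO k ∪ Pcal k

/-- A numerical function `ℕ → ℕ` is `O`-definable if some `O`-definable
set-function maps `{m}` to `{f m}` for every `m`. -/
def NumDef1 (O : ∀ k, Set (SetFun k)) (f : ℕ → ℕ) : Prop :=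
  ∃ F : SetFun 1, ODef O 1 F ∧ ∀ m : ℕ, F (fun _ => {m}) = {f m}

/-- A numerical function `ℕ^k → ℕ` is `O`-definable if some `O`-definable
set-function maps tuples of singletons to the corresponding singleton value. -/
def NumDef (O : ∀ k, Set (SetFun k)) (k : ℕ) (f : (Fin k → ℕ) → ℕ) : Prop :=
  ∃ F : SetFun k, ODef O k F ∧ ∀ m : Fin k → ℕ, F (fun i => ({m i} : Set ℕ)) = {f m}

/-- `f` is regressive: `{f n : f n < n}` is infinite. -/
def Regressive (f : ℕ → ℕ) : Prop := {y | ∃ n, f n = y ∧ y < n}.Infinite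

/-- `f` is semi-regressive: for every `ℓ` there is `n` with `n + ℓ ≤ f n ≤ 2n - 2`. -/
def SemiRegressive (f : ℕ → ℕ) : Prop :=
  ∀ ℓ : ℕ, ∃ n : ℕ, n + ℓ ≤ f n ∧ (f n : ℤ) ≤ 2 * (n : ℤ) - 2

theorem restrict_eq_restrict_iff {s t : Set ℕ} {m : ℕ} :
    restrict s m = restrict t m ↔ ∀ k ≤ m, (k ∈ s ↔ k ∈ t) := by
  simp only [restrict, Set.ext_iff, Set.mem_inter_iff, Set.mem_ofPred_eq, and_congr_left_iff]

/-- `F` is uniformly continuous, with a common modulus, on each piece of a finite partition. -/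
def PiecewiseUnifCont {n : ℕ} (F : SetFun n) : Prop :=
  ∃ (α : Type) (_ : Finite α) (c : (Fin n → Set ℕ) → α) (h : ℕ → ℕ),
    ∀ a, HCont h F {s | c s = a}

theorem HCont.piecewiseUnifCont {n : ℕ} {F : SetFun n} {h : ℕ → ℕ}
    (hF : HCont h F Set.univ) : PiecewiseUnifCont F :=
  ⟨Unit, inferInstance, fun _ => (), h,
    fun _ m s _ t _ hst => hF m s trivial t trivial hst⟩

theorem PiecewiseUnifCont.unifCont_comp {n k : ℕ} {g : SetFun k} {F : Fin k → SetFun n}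
    (hg : UnifCont g Set.univ) (hF : ∀ i, PiecewiseUnifCont (F i)) :
    PiecewiseUnifCont (fun s => g (fun i => F i s)) := by
  obtain ⟨h', hg⟩ := hg
  choose α hα c h hc using hF
  refine ⟨∀ i, α i, inferInstance, fun s i => c i s,
    fun m => Finset.univ.sup fun i => h i (h' m), ?_⟩
  rintro a m s hs t ht hst
  refine hg m _ trivial _ trivial fun i =>
    hc i (a i) (h' m) s (congrFun hs i) t (congrFun ht i) fun j => ?_
  have hij := hst j
  rw [restrict_eq_restrict_iff] at hij ⊢
  exact fun l hl =>
    hij l (hl.trans (Finset.le_sup (f := fun i => h i (h' m)) (Finset.mem_univ i)))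

theorem piecewiseUnifCont_of_predicate {n : ℕ} {F : SetFun n}
    (hF : ∀ s, F s = ∅ ∨ F s = {0}) : PiecewiseUnifCont F := by
  refine ⟨Prop, inferInstance, fun s => F s = {0}, id, ?_⟩
  intro a m s hs t ht _
  have hst : F s = {0} ↔ F t = {0} := iff_of_eq (Eq.trans hs (Eq.symm ht))
  have h_eq : F s = F t := by
    rcases hF s with h | h <;> rcases hF t with h' | h' <;> simp_all
  rw [h_eq]

theorem PiecewiseUnifCont.compl {n : ℕ} {F : SetFun n} (hF : PiecewiseUnifCont F) :
    PiecewiseUnifCont (fun s => (F s)ᶜ) := by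
  refine unifCont_comp (k := 1) (g := fun s => (s 0)ᶜ) (F := fun _ => F)
    ⟨id, fun m s _ t _ hst => ?_⟩ fun _ => hF
  have h := hst 0
  rw [restrict_eq_restrict_iff] at h ⊢
  exact fun k hk => not_congr (h k hk)

theorem PiecewiseUnifCont.union {n : ℕ} {F G : SetFun n} (hF : PiecewiseUnifCont F)
    (hG : PiecewiseUnifCont G) : PiecewiseUnifCont (fun s => F s ∪ G s) := by
  refine unifCont_comp (k := 2) (g := fun s => s 0 ∪ s 1) (F := ![F, G])
    ⟨id, fun m s _ t _ hst => ?_⟩ (Fin.forall_fin_two.2 ⟨hF, hG⟩)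
  have h₀ := hst 0
  have h₁ := hst 1
  rw [restrict_eq_restrict_iff] at h₀ h₁ ⊢
  exact fun k hk => or_congr (h₀ k hk) (h₁ k hk)

theorem PiecewiseUnifCont.inter {n : ℕ} {F G : SetFun n} (hF : PiecewiseUnifCont F)
    (hG : PiecewiseUnifCont G) : PiecewiseUnifCont (fun s => F s ∩ G s) := by
  simpa only [Set.compl_union, compl_compl] using (hF.compl.union hG.compl).compl

theorem ODef.piecewiseUnifCont {n : ℕ} {F : SetFun n} (hF : ODef UPcal n F) :
    PiecewiseUnifCont F := by
  induction hF with
  | proj i => exact HCont.piecewiseUnifCont (h := id) fun m s _ t _ hst => hst i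
  | empty => exact HCont.piecewiseUnifCont (h := id) fun _ _ _ _ _ _ => rfl
  | univ => exact HCont.piecewiseUnifCont (h := id) fun _ _ _ _ _ _ => rfl
  | single k => exact HCont.piecewiseUnifCont (h := id) fun _ _ _ _ _ _ => rfl
  | union _ _ hF hG => exact hF.union hG
  | inter _ _ hF hG => exact hF.inter hG
  | compl _ hF => exact hF.compl
  | comp hg _ hF =>
    rcases hg with hg | hg
    · exact PiecewiseUnifCont.unifCont_comp hg hF
    · exact piecewiseUnifCont_of_predicate fun s => hg _

theorem shoveFun_pair (a j : ℕ) : ShoveFun {a, a + j} = {0, j} := by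
  have h : sInf ({a, a + j} : Set ℕ) = a :=
    IsLeast.csInf_eq ⟨by simp, by rintro x (rfl | rfl) <;> simp⟩
  simp [ShoveFun, h, Set.image_pair]

theorem shove_not_UP_definable :
    ¬ ODef UPcal 1 (fun v => ShoveFun (v 0)) := by
  intro hdef
  obtain ⟨α, _, c, h, hc⟩ := hdef.piecewiseUnifCont
  have := Fintype.ofFinite α
  set N := Fintype.card α
  let s : Fin (N + 1) → Fin 1 → Set ℕ :=
    fun j _ => {h (N + 1) + 1, h (N + 1) + 1 + (j + 1)}
  obtain ⟨i, j, hij, hcij⟩ :=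
    Fintype.exists_ne_map_eq_of_card_lt (fun j => c (s j)) (by simp [N])
  have key := hc _ (N + 1) (s i) hcij (s j) rfl fun l => by
    rw [restrict_eq_restrict_iff]
    intro k hk
    simp only [s, Set.mem_insert_iff, Set.mem_singleton_iff]
    omega
  simp only [s, shoveFun_pair, restrict_eq_restrict_iff] at key
  have := (key (i + 1) (by omega)).1 (Or.inr rfl)
  simp only [Set.mem_insert_iff, Set.mem_singleton_iff] at this
  exact hij (Fin.ext (by omega))

end
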